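/- arXiv:math/9906198 — 2 statements merged into one kernel-verified Lean document; each statement's English description precedes it below -/
import Mathlib

section
/- Let f = (f_1, ..., f_n) be a system of n algebraic functions on a connected n-dimensional algebraic manifold X embedded in ℂ^A, and for i = 1, ..., n let E_i(f) denote the embedded system in variables (x, z_1, ..., z_i) consisting of the equations f_k(x) + Σ_{j=1}^{i} λ_{k,j} z_j = 0 for k = 1, ..., n together with the linear slicing equations a_j + a_{j,1} x_1 + ... + a_{j,A} x_A + z_j = 0 for j = 1, ..., i. Then there is a nonempty Zariski open set U of parameter values (a_j, a_{j,k}, λ_{k,j}) in ℂ^{n×(A+1)} × ℂ^{n×n} such that for every choice of parameters in U and every i = 1, ..., n, all solutions of E_i(x, z_1, ..., z_i) = 0 with (z_1, ..., z_i) ≠ 0 are isolated and nonsingular. -/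
set_option synthInstance.maxHeartbeats 1000000
set_option maxHeartbeats 1000000

open Filter Topology

/-- The common zero set in `ℂ^σ` of a set of polynomials. -/
def zlocus {σ : Type*} (S : Set (MvPolynomial σ ℂ)) : Set (σ → ℂ) :=
  {x | ∀ p ∈ S, MvPolynomial.eval x p = 0}

/-- An (affine) algebraic subset of `ℂ^σ`. -/
def IsAlgSet {σ : Type*} (V : Set (σ → ℂ)) : Prop := ∃ S, V = zlocus S

/-- A Zariski open subset of a complex affine space: the complement of an
algebraic subset. -/
def IsZariskiOpen {σ : Type*} (U : Set (σ → ℂ)) : Prop := IsAlgSet Uᶜ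

/-- `X ⊆ ℂ^A` is a connected algebraic manifold of dimension `n` embedded in `ℂ^A`:
it is an algebraic set, connected (in the Euclidean topology), and near each of its
points it is cut out by `A - n` polynomials whose Jacobian has maximal rank `A - n`. -/
def IsAffineAlgebraicManifold (A n : ℕ) (X : Set (Fin A → ℂ)) : Prop :=
  IsAlgSet X ∧ IsConnected X ∧
    ∀ x ∈ X, ∃ (g : Fin (A - n) → MvPolynomial (Fin A) ℂ) (U : Set (Fin A → ℂ)),
      IsOpen U ∧ x ∈ U ∧ (X ∩ U = {y ∈ U | ∀ k, MvPolynomial.eval y (g k) = 0}) ∧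
      (Matrix.of fun k t => MvPolynomial.eval x (MvPolynomial.pderiv t (g k))).rank = A - n

/-- A point `p` is an isolated point of the set `S`. -/
def IsIsolatedIn {α : Type*} [TopologicalSpace α] (S : Set α) (p : α) : Prop :=
  p ∈ S ∧ ∃ U : Set α, IsOpen U ∧ p ∈ U ∧ S ∩ U = {p}

/-- The index type of the parameter space `ℂ^{n×(A+1)} × ℂ^{n×n}` for the embedding:
coefficients of the affine-linear slicing functions `L_j` and multipliers `λ_{k,j}`. -/
abbrev EmbParam (A n : ℕ) := (Fin n × Fin (A + 1)) ⊕ (Fin n × Fin n)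

/-- The `j`-th affine-linear slicing function `L_j(x) = a_j + a_{j,1}x_1 + ⋯ + a_{j,A}x_A`. -/
noncomputable def Lval {A n : ℕ} (y : EmbParam A n → ℂ) (j : Fin n) (x : Fin A → ℂ) : ℂ :=
  y (Sum.inl (j, 0)) + ∑ t : Fin A, y (Sum.inl (j, t.succ)) * x t

/-- The multiplier `λ_{k,j}` from the parameter vector. -/
def lamval {A n : ℕ} (y : EmbParam A n → ℂ) (k j : Fin n) : ℂ := y (Sum.inr (k, j))

/-- The value of a rational (algebraic) function given by numerator `p` and
denominator `q`. -/
noncomputable def ratval {A : ℕ} (p q : MvPolynomial (Fin A) ℂ) (x : Fin A → ℂ) : ℂ :=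
  MvPolynomial.eval x p / MvPolynomial.eval x q

/-- The embedded system `E_i(f)`: the map whose vanishing expresses
`f_k(x) + Σ_{j=1}^{i} λ_{k,j} z_j = 0` (k = 1, …, n) together with the slicing
equations `L_j(x) + z_j = 0` (j = 1, …, i).  Here the algebraic functions `f_k` are
given as rational functions `fp k / fq k`. -/
noncomputable def Emap {A n : ℕ} (fp fq : Fin n → MvPolynomial (Fin A) ℂ)
    (i : ℕ) (hin : i ≤ n) (y : EmbParam A n → ℂ)
    (p : (Fin A → ℂ) × (Fin i → ℂ)) : (Fin n → ℂ) × (Fin i → ℂ) :=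
  (fun k => ratval (fp k) (fq k) p.1 + ∑ j : Fin i, lamval y k (j.castLE hin) * p.2 j,
   fun j => Lval y (j.castLE hin) p.1 + p.2 j)

/-- The solution set of the embedded system `E_i(f) = 0` on `X × ℂ^i`. -/
noncomputable def ESol {A n : ℕ} (X : Set (Fin A → ℂ))
    (fp fq : Fin n → MvPolynomial (Fin A) ℂ)
    (i : ℕ) (hin : i ≤ n) (y : EmbParam A n → ℂ) :
    Set ((Fin A → ℂ) × (Fin i → ℂ)) :=
  {p | p.1 ∈ X ∧ Emap fp fq i hin y p = 0}

/-- A solution `p` of `E_i(f) = 0` on the `n`-dimensional algebraic manifold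
`X ⊆ ℂ^A` is nonsingular: together with `A - n` local defining equations `g` for
`X` having maximal-rank Jacobian, the system has invertible (bijective) derivative
at `p`. -/
noncomputable def IsNonsingularSolution {A n : ℕ} (X : Set (Fin A → ℂ))
    (fp fq : Fin n → MvPolynomial (Fin A) ℂ)
    (i : ℕ) (hin : i ≤ n) (y : EmbParam A n → ℂ)
    (p : (Fin A → ℂ) × (Fin i → ℂ)) : Prop :=
  p ∈ ESol X fp fq i hin y ∧
  ∃ (g : Fin (A - n) → MvPolynomial (Fin A) ℂ) (U : Set (Fin A → ℂ)),
    IsOpen U ∧ p.1 ∈ U ∧ (X ∩ U = {x ∈ U | ∀ k, MvPolynomial.eval x (g k) = 0}) ∧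
    (Matrix.of fun k t => MvPolynomial.eval p.1 (MvPolynomial.pderiv t (g k))).rank = A - n ∧
    Function.Bijective
      (fderiv ℂ (fun q : (Fin A → ℂ) × (Fin i → ℂ) =>
        ((fun k => MvPolynomial.eval q.1 (g k) : Fin (A - n) → ℂ),
          Emap fp fq i hin y q)) p)

/-- Over a field of characteristic zero, a derivation of an extension field can be prescribed
arbitrarily on an algebraically independent family. -/
theorem AlgebraicIndependent.exists_derivation {k K σ : Type*} [Field k] [CharZero k] [Field K]
    [Algebra k K] {y : σ → K} (hy : AlgebraicIndependent k y) (c : σ → K) :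
    ∃ D : Derivation k K K, ∀ s, D (y s) = c s := by
  classical
  let R := MvPolynomial σ k
  let L := FractionRing R
  have hinj : Function.Injective (MvPolynomial.aeval y : R →ₐ[k] K) := hy
  let ψ : R →ₐ[k] DualNumber K :=
    MvPolynomial.aeval fun s => TrivSqZeroExt.inl (y s) + TrivSqZeroExt.inr (c s)
  let fst : DualNumber K →ₐ[k] K := TrivSqZeroExt.fstHom k K K
  have hfst : fst.comp ψ = MvPolynomial.aeval y := by
    ext s; simp [ψ, fst]
  have hunit : ∀ P : nonZeroDivisors R, IsUnit (ψ P) := fun P => by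
    rw [TrivSqZeroExt.isUnit_iff_isUnit_fst, isUnit_iff_ne_zero]
    have h : (ψ P).fst = MvPolynomial.aeval y (P : R) := DFunLike.congr_fun hfst (P : R)
    rw [h]
    exact (map_ne_zero_iff _ hinj).2 (nonZeroDivisors.coe_ne_zero P)
  let Ψ : L →+* DualNumber K := IsLocalization.lift (M := nonZeroDivisors R) (g := ψ.toRingHom) hunit
  let ι : L →+* K := (fst : DualNumber K →+* K).comp Ψ
  let : Algebra L (DualNumber K) := Ψ.toAlgebra
  let : Algebra L K := ι.toAlgebra
  have hΨ : ∀ P : R, Ψ (algebraMap R L P) = ψ P := fun P => IsLocalization.lift_eq _ P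
  have : CharZero L := charZero_of_injective_algebraMap
    (FaithfulSMul.algebraMap_injective k L)
  obtain ⟨τ, x, hx⟩ := exists_isTranscendenceBasis' L K
  have := hx.isAlgebraic_field
  have : Algebra.FormallySmooth L K := .of_algebraicIndependent_of_isSeparable hx.1
  let F : DualNumber K →ₐ[L] K := { (fst : DualNumber K →+* K) with commutes' := fun _ => rfl }
  have hF : Function.Surjective F := fun a => ⟨TrivSqZeroExt.inl a, rfl⟩
  have hnil : IsNilpotent (RingHom.ker (F : DualNumber K →+* K)) := by
    have h : RingHom.ker (F : DualNumber K →+* K) * RingHom.ker (F : DualNumber K →+* K) ≤ ⊥ := by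
      rw [Ideal.mul_le]
      intro a ha b hb
      have ha' : a.fst = 0 := ha
      have hb' : b.fst = 0 := hb
      rw [Ideal.mem_bot]
      ext <;> simp [ha', hb']
    exact ⟨2, by rw [Submodule.pow_succ, Submodule.pow_one]; exact le_bot_iff.1 h⟩
  let s : K →ₐ[L] DualNumber K := Algebra.FormallySmooth.liftOfSurjective (AlgHom.id L K) F hF hnil
  have hs : ∀ a, (s a).fst = a := fun a =>
    Algebra.FormallySmooth.liftOfSurjective_apply (AlgHom.id L K) F hF hnil a
  have hsR : ∀ P : R, s (MvPolynomial.aeval y P) = ψ P := fun P => by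
    have h1 : MvPolynomial.aeval y P = algebraMap L K (algebraMap R L P) := by
      rw [← hfst]
      change fst (ψ P) = fst (Ψ (algebraMap R L P))
      rw [hΨ]
    rw [h1, s.commutes]
    exact hΨ P
  refine ⟨Derivation.mk' { toFun := fun a => (s a).snd, map_add' := ?_, map_smul' := ?_ } ?_, ?_⟩
  · intro a b; simp
  · intro r a
    have h : s (algebraMap k K r) = algebraMap k _ r := by
      have := hsR (MvPolynomial.C r)
      rwa [MvPolynomial.aeval_C, show ψ (MvPolynomial.C r) = algebraMap k _ r from ψ.commutes r]
        at this
    simp [Algebra.smul_def, h, hs, TrivSqZeroExt.algebraMap_eq_inl']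
  · intro a b; simp [hs, mul_comm]
  · intro j
    have := hsR (MvPolynomial.X j)
    rw [MvPolynomial.aeval_X, show ψ (MvPolynomial.X j) = _ from MvPolynomial.aeval_X _ _] at this
    simp [this]

/-- The ring of functions modulo equality along an ultrafilter is a field. -/
theorem Ultrafilter.exists_field_of_germs.{u, v} {W : Type u} (φ : Ultrafilter W) (k : Type v)
    [Field k] :
    ∃ (K : Type (max u v)) (_ : Field K) (π : (W → k) →+* K), Function.Surjective π ∧
      ∀ f g, π f = π g ↔ ∀ᶠ w in φ, f w = g w :=
  ⟨(φ : Filter W).Germ k, inferInstance, Germ.coeRingHom _,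
    fun a => Quotient.inductionOn' a fun f => ⟨f, rfl⟩, fun _ _ => Germ.coe_eq⟩

/-- Along an ultrafilter at which the functions `y · s` are algebraically independent over a field
`k` of characteristic zero, there is an operator on functions which is a derivation modulo
equality along the ultrafilter and takes prescribed values on the functions `y · s`. -/
theorem Ultrafilter.exists_derivation {W σ k : Type*} [Field k] [CharZero k] (φ : Ultrafilter W)
    (y : W → σ → k)
    (hy : ∀ P : MvPolynomial σ k, P ≠ 0 → ∀ᶠ w in φ, MvPolynomial.eval (y w) P ≠ 0)
    (c : W → σ → k) :
    ∃ D : (W → k) →ₗ[k] (W → k),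
      (∀ f g, ∀ᶠ w in φ, D (f * g) w = f w * D g w + g w * D f w) ∧
      (∀ a : k, D (fun _ => a) = 0) ∧
      ∀ s, ∀ᶠ w in φ, D (fun w => y w s) w = c w s := by
  obtain ⟨K, _, π, hsurj, hπ⟩ := φ.exists_field_of_germs k
  let : Algebra k K := (π.comp (algebraMap k (W → k))).toAlgebra
  let π' : (W → k) →ₐ[k] K := { π with commutes' := fun _ => rfl }
  have hind : AlgebraicIndependent k fun s => π' fun w => y w s := by
    rw [algebraicIndependent_iff]
    intro P hP
    by_contra h0
    have h1 : (MvPolynomial.aeval fun s => π' fun w => y w s) P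
        = π' (fun w => MvPolynomial.eval (y w) P) := by
      have h2 : (fun w => MvPolynomial.eval (y w) P)
          = MvPolynomial.aeval (fun s (w : W) => y w s) P := by
        funext w
        rw [← MvPolynomial.coe_aeval_eq_eval]
        exact (DFunLike.congr_fun
          (MvPolynomial.comp_aeval (fun s (w : W) => y w s) (Pi.evalAlgHom k (fun _ : W => k) w))
          P).symm
      rw [h2, ← AlgHom.comp_apply, MvPolynomial.comp_aeval]
    rw [h1, ← map_zero π'] at hP
    obtain ⟨w, hw1, hw2⟩ := (((hπ _ _).1 hP).and (hy P h0)).exists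
    exact hw2 hw1
  obtain ⟨D, hD⟩ := hind.exists_derivation fun s => π' fun w => c w s
  obtain ⟨r, hr⟩ := π'.toLinearMap.exists_rightInverse_of_surjective
    (LinearMap.range_eq_top.2 hsurj)
  have hr' : ∀ a, π (r a) = a := fun a => LinearMap.congr_fun hr a
  refine ⟨r ∘ₗ D.toLinearMap ∘ₗ π'.toLinearMap, ?_, ?_, ?_⟩
  · intro f g
    refine (hπ _ (f * r (D (π g)) + g * r (D (π f)))).1 ?_
    simp only [map_add π, map_mul π, hr']
    change π (r (D (π (f * g)))) = _
    rw [hr', map_mul, D.leibniz, smul_eq_mul, smul_eq_mul]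
  · intro a
    change r (D (algebraMap k K a)) = 0
    rw [D.map_algebraMap, map_zero]
  · intro s
    refine (hπ _ fun w => c w s).1 ?_
    exact (hr' _).trans (hD s)

/-- A family of points that is not contained in any hypersurface carries an ultrafilter that is
generic, in the sense that no hypersurface contains almost all of the points. -/
theorem exists_generic_ultrafilter {W σ k : Type*} [Field k] (y : W → σ → k)
    (h : ∀ P : MvPolynomial σ k, P ≠ 0 → ∃ w, MvPolynomial.eval (y w) P ≠ 0) :
    ∃ φ : Ultrafilter W,
      ∀ P : MvPolynomial σ k, P ≠ 0 → ∀ᶠ w in φ, MvPolynomial.eval (y w) P ≠ 0 := by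
  classical
  let S : {P : MvPolynomial σ k // P ≠ 0} → Set W :=
    fun P => {w | MvPolynomial.eval (y w) P.1 ≠ 0}
  have hne : (⨅ P, 𝓟 (S P)).NeBot := by
    have : Nonempty {P : MvPolynomial σ k // P ≠ 0} := ⟨⟨1, one_ne_zero⟩⟩
    refine iInf_neBot_of_directed' ?_ fun P => principal_neBot_iff.2 (h P.1 P.2)
    intro P Q
    refine ⟨⟨P.1 * Q.1, mul_ne_zero P.2 Q.2⟩, ?_, ?_⟩ <;>
    · simp only [ge_iff_le, le_principal_iff, mem_principal]
      intro w hw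
      simp only [S, Set.mem_ofPred_eq, map_mul, mul_ne_zero_iff] at hw ⊢
      tauto
  refine ⟨Ultrafilter.of (⨅ P, 𝓟 (S P)), fun P hP => ?_⟩
  exact Ultrafilter.of_le _ (mem_iInf_of_mem (⟨P, hP⟩ : {P : MvPolynomial σ k // P ≠ 0})
    (mem_principal_self _))

/-- The chain rule for polynomials and an operator that is a derivation modulo a filter. -/
theorem eventually_derivation_eval {W τ k : Type*} [Fintype τ] [Field k] {φ : Filter W}
    {D : (W → k) →ₗ[k] (W → k)}
    (hD : ∀ f g, ∀ᶠ w in φ, D (f * g) w = f w * D g w + g w * D f w)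
    (hC : ∀ a : k, D (fun _ => a) = 0) (x : W → τ → k) (P : MvPolynomial τ k) :
    ∀ᶠ w in φ, D (fun w => MvPolynomial.eval (x w) P) w =
      ∑ t, MvPolynomial.eval (x w) (MvPolynomial.pderiv t P) * D (fun w => x w t) w := by
  classical
  induction P using MvPolynomial.induction_on with
  | C a => simp [hC]
  | add P Q hP hQ =>
    filter_upwards [hP, hQ] with w hP hQ
    have : (fun w => MvPolynomial.eval (x w) (P + Q)) =
      (fun w => MvPolynomial.eval (x w) P) + fun w => MvPolynomial.eval (x w) Q := by
      funext w; simp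
    rw [this, map_add, Pi.add_apply, hP, hQ, ← Finset.sum_add_distrib]
    simp [add_mul]
  | mul_X P s hP =>
    filter_upwards [hP, hD (fun w => MvPolynomial.eval (x w) P) fun w => x w s] with w hP h
    have : (fun w => MvPolynomial.eval (x w) (P * MvPolynomial.X s)) =
      (fun w => MvPolynomial.eval (x w) P) * fun w => x w s := by
      funext w; simp
    rw [this, h, hP, Finset.mul_sum]
    simp only [Derivation.leibniz, MvPolynomial.pderiv_X, smul_eq_mul, map_add, map_mul, add_mul,
      Finset.sum_add_distrib, MvPolynomial.eval_X]
    congr 1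
    · rw [Finset.sum_eq_single s]
      · simp
      · intro t _ ht
        simp [ht.symm]
      · simp
    · exact Finset.sum_congr rfl fun t _ => by ring

/-- A map that is analytic with surjective derivative at a point is, in suitable analytic local
coordinates, the projection to the first factor of a product. -/
theorem AnalyticAt.exists_straightening {E F : Type*} [NormedAddCommGroup E] [NormedSpace ℂ E]
    [CompleteSpace E] [NormedAddCommGroup F] [NormedSpace ℂ F] [FiniteDimensional ℂ F]
    {G : E → F} {a : E} (hG : AnalyticAt ℂ G a) (hsurj : Function.Surjective (fderiv ℂ G a)) :
    ∃ e : OpenPartialHomeomorph E (F × (fderiv ℂ G a).ker), a ∈ e.source ∧ (∀ x, (e x).1 = G x) ∧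
      AnalyticAt ℂ e.symm (e a) := by
  have := FiniteDimensional.complete ℂ F
  have hker := (fderiv ℂ G a).ker_closedComplemented_of_finiteDimensional_range
  obtain ⟨ρ, hρ⟩ := hker
  let i := (fderiv ℂ G a).equivProdOfSurjectiveOfIsCompl ρ (LinearMap.range_eq_top.2 hsurj)
    (LinearMap.range_eq_of_proj hρ) (LinearMap.isCompl_of_proj hρ)
  have hd : HasStrictFDerivAt (fun x => (G x, ρ x))
      (i : E →L[ℂ] F × (fderiv ℂ G a).ker) a :=
    hG.hasStrictFDerivAt.prodMk ρ.hasStrictFDerivAt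
  refine ⟨hd.toOpenPartialHomeomorph _, hd.mem_toOpenPartialHomeomorph_source, fun _ => rfl, ?_⟩
  refine OpenPartialHomeomorph.analyticAt_symm' (i := i) _ hd.mem_toOpenPartialHomeomorph_source
    (hG.prod (ρ.analyticAt a)) hd.hasFDerivAt.fderiv

/-- The local identity principle on the zero set of an analytic submersion. -/
theorem AnalyticAt.exists_identity_nhd {E F : Type*} [NormedAddCommGroup E] [NormedSpace ℂ E]
    [CompleteSpace E] [NormedAddCommGroup F] [NormedSpace ℂ F] [FiniteDimensional ℂ F]
    {G : E → F} {a : E} (hG : AnalyticAt ℂ G a) (hsurj : Function.Surjective (fderiv ℂ G a))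
    {p : E → ℂ} (hp : AnalyticOnNhd ℂ p Set.univ) (ha : G a = 0) :
    ∀ᶠ N in (𝓝 a).smallSets, ∀ b ∈ N, G b = 0 → (∀ᶠ y in 𝓝 b, G y = 0 → p y = 0) →
      ∀ y ∈ N, G y = 0 → p y = 0 := by
  obtain ⟨e, hae, he1, hsymm⟩ := hG.exists_straightening hsurj
  obtain ⟨r, hr, hball⟩ := Metric.mem_nhds_iff.1
    (inter_mem (e.open_target.mem_nhds (e.map_source hae)) hsymm.eventually_analyticAt)
  have hN : e.source ∩ e ⁻¹' Metric.ball (e a) r ∈ 𝓝 a :=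
    (e.isOpen_inter_preimage Metric.isOpen_ball).mem_nhds ⟨hae, Metric.mem_ball_self hr⟩
  refine eventually_smallSets.2 ⟨_, hN, ?_⟩
  intro N hNN b hbN hb hloc y hyN hy
  have hmem : ∀ z ∈ N, z ∈ e.source ∧ e z ∈ Metric.ball (e a) r := fun z hz => hNN hz
  have hsnd : ∀ z ∈ N, (e z).2 ∈ Metric.ball (e a).2 r := fun z hz =>
    (max_lt_iff.1 (Metric.mem_ball.1 (hmem z hz).2)).2
  have hin : ∀ u ∈ Metric.ball (e a).2 r, ((0 : F), u) ∈ Metric.ball (e a) r := by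
    intro u hu
    rw [Metric.mem_ball, Prod.dist_eq, he1, ha]
    exact max_lt (by simpa using hr) hu
  have hzero : ∀ z, G z = 0 → ((0 : F), (e z).2) = e z := fun z hz => by
    ext1
    · exact (he1 z).trans hz |>.symm
    · rfl
  let h : (fderiv ℂ G a).ker → ℂ := fun u => p (e.symm (0, u))
  have hh : AnalyticOnNhd ℂ h (Metric.ball (e a).2 r) := by
    intro u hu
    have h1 : AnalyticAt ℂ e.symm ((0 : F), u) := (hball (hin u hu)).2
    have h2 : AnalyticAt ℂ (fun u : (fderiv ℂ G a).ker => e.symm ((0 : F), u)) u :=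
      h1.comp (f := fun u : (fderiv ℂ G a).ker => ((0 : F), u))
        (analyticAt_const.prod analyticAt_id)
    exact (hp _ (Set.mem_univ _)).comp h2
  have hev : h =ᶠ[𝓝 (e b).2] 0 := by
    have hcont : ContinuousAt (fun u : (fderiv ℂ G a).ker => e.symm ((0 : F), u)) (e b).2 := by
      have h1 : ContinuousAt e.symm ((0 : F), (e b).2) := by
        rw [hzero b hb]
        exact e.continuousAt_symm (e.map_source (hmem b hbN).1)
      exact h1.comp (f := fun u : (fderiv ℂ G a).ker => ((0 : F), u)) (by fun_prop)
    have hb' : e.symm ((0 : F), (e b).2) = b := by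
      rw [hzero b hb, e.left_inv (hmem b hbN).1]
    have hev1 := hcont.eventually (p := fun y => G y = 0 → p y = 0) (by simpa only [hb'] using hloc)
    filter_upwards [hev1, Metric.isOpen_ball.mem_nhds (hsnd b hbN)] with u hu hu'
    refine hu ?_
    rw [← he1, e.right_inv (hball (hin u hu')).1]
  have hres := hh.eqOn_zero_of_preconnected_of_eventuallyEq_zero
    (convex_ball _ _).isPreconnected (hsnd b hbN) hev (hsnd y hyN)
  simpa [h, hzero y hy, e.left_inv (hmem y hyN).1] using hres

/-- If an identity principle holds locally on a preconnected set, then it holds globally. -/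
theorem IsPreconnected.forall_of_eventually_of_local {E : Type*} [TopologicalSpace E] {X : Set E}
    (hX : IsPreconnected X) {Q : E → Prop}
    (hloc : ∀ x ∈ X, ∃ N ∈ 𝓝 x, ∀ b ∈ N, b ∈ X → (∀ᶠ y in 𝓝 b, y ∈ X → Q y) →
      ∀ y ∈ N, y ∈ X → Q y)
    {a : E} (ha : a ∈ X) (hQ : ∀ᶠ y in 𝓝 a, y ∈ X → Q y) : ∀ x ∈ X, Q x := by
  by_contra! hcon
  obtain ⟨x, hx, hQx⟩ := hcon
  let u : Set E := {b | ∀ᶠ y in 𝓝 b, y ∈ X → Q y}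
  let v : Set E := {b | ∀ᶠ y in 𝓝 b, y ∈ X → y ∉ u}
  have hcover : X ⊆ u ∪ v := by
    intro z hz
    obtain ⟨N, hN, h⟩ := hloc z hz
    by_cases hex : ∃ b ∈ N, b ∈ X ∧ b ∈ u
    · obtain ⟨b, hbN, hbX, hbu⟩ := hex
      exact Or.inl (mem_of_superset hN (h b hbN hbX hbu))
    · push Not at hex
      exact Or.inr (mem_of_superset hN hex)
  have hxu : x ∉ u := fun h => hQx (Eventually.self_of_nhds h hx)
  obtain ⟨b, hbX, hbu, hbv⟩ := hX u v isOpen_setOfPred_eventually_nhds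
    isOpen_setOfPred_eventually_nhds hcover ⟨a, ha, hQ⟩ ⟨x, hx, (hcover hx).resolve_left hxu⟩
  exact Eventually.self_of_nhds hbv hbX hbu

/-- The differential of a polynomial function at a point. -/
noncomputable def MvPolynomial.evalDeriv {τ : Type*} [Fintype τ] (P : MvPolynomial τ ℂ)
    (x : τ → ℂ) : (τ → ℂ) →L[ℂ] ℂ :=
  ∑ t, MvPolynomial.eval x (MvPolynomial.pderiv t P) • ContinuousLinearMap.proj t

theorem MvPolynomial.evalDeriv_apply {τ : Type*} [Fintype τ] (P : MvPolynomial τ ℂ)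
    (x u : τ → ℂ) :
    P.evalDeriv x u = ∑ t, MvPolynomial.eval x (MvPolynomial.pderiv t P) * u t := by
  simp [MvPolynomial.evalDeriv]

theorem MvPolynomial.evalDeriv_add {τ : Type*} [Fintype τ] (P Q : MvPolynomial τ ℂ)
    (x : τ → ℂ) : (P + Q).evalDeriv x = P.evalDeriv x + Q.evalDeriv x := by
  ext u
  simp [MvPolynomial.evalDeriv_apply, add_mul, Finset.sum_add_distrib]

theorem MvPolynomial.evalDeriv_mul {τ : Type*} [Fintype τ] (P Q : MvPolynomial τ ℂ)
    (x : τ → ℂ) : (P * Q).evalDeriv x =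
      MvPolynomial.eval x P • Q.evalDeriv x + MvPolynomial.eval x Q • P.evalDeriv x := by
  ext u
  simp [MvPolynomial.evalDeriv_apply, add_mul, Finset.sum_add_distrib, Finset.mul_sum, mul_assoc]

theorem MvPolynomial.hasFDerivAt_eval {τ : Type*} [Fintype τ] (P : MvPolynomial τ ℂ)
    (x : τ → ℂ) : HasFDerivAt (fun x => MvPolynomial.eval x P) (P.evalDeriv x) x := by
  classical
  induction P using MvPolynomial.induction_on with
  | C a =>
    have hC : (MvPolynomial.C a : MvPolynomial τ ℂ).evalDeriv x = 0 := by
      ext u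
      simp [MvPolynomial.evalDeriv_apply]
    simpa [hC] using hasFDerivAt_const (𝕜 := ℂ) a x
  | add P Q hP hQ =>
    rw [MvPolynomial.evalDeriv_add]
    simp only [map_add]
    exact hP.add hQ
  | mul_X P s hP =>
    have hX : (MvPolynomial.X s : MvPolynomial τ ℂ).evalDeriv x = ContinuousLinearMap.proj s := by
      ext u
      rw [MvPolynomial.evalDeriv_apply]
      simp [MvPolynomial.pderiv_X, Pi.single_apply]
    rw [MvPolynomial.evalDeriv_mul, hX]
    simp only [map_mul, MvPolynomial.eval_X]
    exact hP.mul (ContinuousLinearMap.proj (R := ℂ) (φ := fun _ : τ => ℂ) s).hasFDerivAt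

/-- A polynomial differential vanishing on generators of an ideal, at a common zero of the ideal,
vanishes on the whole ideal. -/
theorem MvPolynomial.evalDeriv_eq_zero_of_mem_span {τ : Type*} [Fintype τ]
    {S : Set (MvPolynomial τ ℂ)} {x u : τ → ℂ} (hx : ∀ q ∈ S, MvPolynomial.eval x q = 0)
    (hu : ∀ q ∈ S, q.evalDeriv x u = 0) {P : MvPolynomial τ ℂ} (hP : P ∈ Ideal.span S) :
    P.evalDeriv x u = 0 := by
  suffices MvPolynomial.eval x P = 0 ∧ P.evalDeriv x u = 0 from this.2
  induction hP using Submodule.span_induction with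
  | mem q hq => exact ⟨hx q hq, hu q hq⟩
  | zero => simp [MvPolynomial.evalDeriv]
  | add P Q _ _ hP hQ => simp [MvPolynomial.evalDeriv_add, hP, hQ]
  | smul a P _ hP => simp [MvPolynomial.evalDeriv_mul, hP]

/-- The differential of a tuple of polynomials whose Jacobian matrix has full row rank is
surjective. -/
theorem MvPolynomial.surjective_evalDeriv {τ : Type*} [Fintype τ] {m : ℕ}
    {g : Fin m → MvPolynomial τ ℂ} {x : τ → ℂ}
    (hg : (Matrix.of fun k t => MvPolynomial.eval x (MvPolynomial.pderiv t (g k))).rank = m) :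
    Function.Surjective (ContinuousLinearMap.pi fun k => (g k).evalDeriv x) := by
  rw [Matrix.rank] at hg
  have htop := Submodule.eq_top_of_finrank_eq (hg.trans (by simp :
    m = Module.finrank ℂ (Fin m → ℂ)))
  intro γ
  obtain ⟨u, hu⟩ := LinearMap.range_eq_top.1 htop γ
  refine ⟨u, ?_⟩
  rw [← hu]
  funext k
  simp [MvPolynomial.evalDeriv_apply, Matrix.mulVec, dotProduct]

theorem MvPolynomial.hasFDerivAt_eval_pi {τ : Type*} [Fintype τ] {m : ℕ}
    (g : Fin m → MvPolynomial τ ℂ) (x : τ → ℂ) :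
    HasFDerivAt (fun x k => MvPolynomial.eval x (g k))
      (ContinuousLinearMap.pi fun k => (g k).evalDeriv x) x :=
  hasFDerivAt_pi.2 fun k => (g k).hasFDerivAt_eval x

/-- A polynomial vanishing on a connected manifold near one of its points vanishes on the whole
manifold. -/
theorem IsAffineAlgebraicManifold.eval_eq_zero {A n : ℕ} {X : Set (Fin A → ℂ)}
    (hX : IsAffineAlgebraicManifold A n X) (P : MvPolynomial (Fin A) ℂ) {a : Fin A → ℂ}
    (ha : a ∈ X) (hP : ∀ᶠ y in 𝓝 a, y ∈ X → MvPolynomial.eval y P = 0) :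
    ∀ x ∈ X, MvPolynomial.eval x P = 0 := by
  refine hX.2.1.isPreconnected.forall_of_eventually_of_local (fun x hx => ?_) ha hP
  obtain ⟨g, U, hUo, hxU, hXU, hrank⟩ := hX.2.2 x hx
  have hiff : ∀ y ∈ U, y ∈ X ↔ (fun k => MvPolynomial.eval y (g k)) = 0 := fun y hy => by
    have := Set.ext_iff.1 hXU y
    rw [funext_iff]
    simpa [hy] using this
  have hG : AnalyticAt ℂ (fun y k => MvPolynomial.eval y (g k)) x :=
    AnalyticAt.pi fun k => AnalyticOnNhd.eval_mvPolynomial (g k) x (Set.mem_univ _)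
  have hev := hG.exists_identity_nhd
    (by rw [(MvPolynomial.hasFDerivAt_eval_pi g x).fderiv]
        exact MvPolynomial.surjective_evalDeriv hrank)
    (AnalyticOnNhd.eval_mvPolynomial P) ((hiff x hxU).1 hx)
  obtain ⟨N, hN, h⟩ := eventually_smallSets.1 hev
  refine ⟨N ∩ U, inter_mem hN (hUo.mem_nhds hxU), fun b hb hbX hloc y hy hyX => ?_⟩
  refine h (N ∩ U) Set.inter_subset_left b hb ((hiff b hb.2).1 hbX) ?_ y hy ((hiff y hy.2).1 hyX)
  filter_upwards [hloc, hUo.mem_nhds hb.2] with z hz hzU hGz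
  exact hz ((hiff z hzU).2 hGz)

/-- The differential of a rational function at a point. -/
noncomputable def ratDeriv {A : ℕ} (p q : MvPolynomial (Fin A) ℂ) (x : Fin A → ℂ) :
    (Fin A → ℂ) →L[ℂ] ℂ :=
  (MvPolynomial.eval x q)⁻¹ • (p.evalDeriv x - ratval p q x • q.evalDeriv x)

theorem hasFDerivAt_ratval {A : ℕ} (p q : MvPolynomial (Fin A) ℂ) {x : Fin A → ℂ}
    (hx : MvPolynomial.eval x q ≠ 0) : HasFDerivAt (ratval p q) (ratDeriv p q x) x := by
  have h := (p.hasFDerivAt_eval x).mul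
    ((hasDerivAt_inv hx).comp_hasFDerivAt x (q.hasFDerivAt_eval x))
  refine (h.congr_fderiv ?_).congr_of_eventuallyEq (.of_forall fun z => ?_)
  · ext u
    simp only [ratDeriv, ratval, add_apply, smul_apply,
      sub_apply, smul_eq_mul, Function.comp_apply]
    field_simp
    ring
  · simp [ratval, div_eq_mul_inv]

/-- The differential of the embedded system `E_i(f)` at the point `(x, z)`; it does not depend
on `z`. -/
noncomputable def EmapDeriv {A n : ℕ} (fp fq : Fin n → MvPolynomial (Fin A) ℂ)
    (i : ℕ) (hin : i ≤ n) (y : EmbParam A n → ℂ) (x : Fin A → ℂ) :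
    (Fin A → ℂ) × (Fin i → ℂ) →L[ℂ] (Fin n → ℂ) × (Fin i → ℂ) :=
  (ContinuousLinearMap.pi fun k =>
    (ratDeriv (fp k) (fq k) x).comp (ContinuousLinearMap.fst ℂ _ _) +
      (∑ j : Fin i, lamval y k (j.castLE hin) • ContinuousLinearMap.proj j).comp
        (ContinuousLinearMap.snd ℂ _ _)).prod
  (ContinuousLinearMap.pi fun j =>
    (∑ t : Fin A, y (Sum.inl (j.castLE hin, t.succ)) • ContinuousLinearMap.proj t).comp
      (ContinuousLinearMap.fst ℂ _ _) +
    (ContinuousLinearMap.proj j).comp (ContinuousLinearMap.snd ℂ _ _))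

theorem EmapDeriv_apply {A n : ℕ} (fp fq : Fin n → MvPolynomial (Fin A) ℂ)
    (i : ℕ) (hin : i ≤ n) (y : EmbParam A n → ℂ) (x : Fin A → ℂ)
    (v : (Fin A → ℂ) × (Fin i → ℂ)) :
    EmapDeriv fp fq i hin y x v =
      (fun k => ratDeriv (fp k) (fq k) x v.1 + ∑ j : Fin i, lamval y k (j.castLE hin) * v.2 j,
        fun j => ∑ t : Fin A, y (Sum.inl (j.castLE hin, t.succ)) * v.1 t + v.2 j) := by
  ext j <;> simp [EmapDeriv]

theorem hasFDerivAt_Emap {A n : ℕ} {fp fq : Fin n → MvPolynomial (Fin A) ℂ}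
    {i : ℕ} (hin : i ≤ n) (y : EmbParam A n → ℂ) {p : (Fin A → ℂ) × (Fin i → ℂ)}
    (hq : ∀ k, MvPolynomial.eval p.1 (fq k) ≠ 0) :
    HasFDerivAt (Emap fp fq i hin y) (EmapDeriv fp fq i hin y p.1) p := by
  refine HasFDerivAt.prodMk (hasFDerivAt_pi.2 fun k => ?_) (hasFDerivAt_pi.2 fun j => ?_)
  · refine ((hasFDerivAt_ratval (fp k) (fq k) (hq k)).comp p hasFDerivAt_fst).add ?_
    refine ((ContinuousLinearMap.comp (∑ j : Fin i, lamval y k (j.castLE hin) •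
      ContinuousLinearMap.proj j) (ContinuousLinearMap.snd ℂ (Fin A → ℂ)
        (Fin i → ℂ))).hasFDerivAt (x := p)).congr_of_eventuallyEq (.of_forall fun q => ?_)
    simp
  · refine HasFDerivAt.add ?_ (((ContinuousLinearMap.proj (R := ℂ) (φ := fun _ => ℂ) j).comp
      (ContinuousLinearMap.snd ℂ (Fin A → ℂ) (Fin i → ℂ))).hasFDerivAt (x := p))
    refine HasFDerivAt.const_add (y (Sum.inl (j.castLE hin, 0))) ?_
    refine ((ContinuousLinearMap.comp (∑ t : Fin A, y (Sum.inl (j.castLE hin, t.succ)) •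
      ContinuousLinearMap.proj t) (ContinuousLinearMap.fst ℂ (Fin A → ℂ)
        (Fin i → ℂ))).hasFDerivAt (x := p)).congr_of_eventuallyEq (.of_forall fun q => ?_)
    simp

theorem hasFDerivAt_eval_prod_Emap {A n m : ℕ} {fp fq : Fin n → MvPolynomial (Fin A) ℂ}
    (g : Fin m → MvPolynomial (Fin A) ℂ)
    {i : ℕ} (hin : i ≤ n) (y : EmbParam A n → ℂ) {p : (Fin A → ℂ) × (Fin i → ℂ)}
    (hq : ∀ k, MvPolynomial.eval p.1 (fq k) ≠ 0) :
    HasFDerivAt (fun q : (Fin A → ℂ) × (Fin i → ℂ) =>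
        ((fun k => MvPolynomial.eval q.1 (g k) : Fin m → ℂ), Emap fp fq i hin y q))
      (((ContinuousLinearMap.pi fun k => (g k).evalDeriv p.1).comp
        (ContinuousLinearMap.fst ℂ _ _)).prod (EmapDeriv fp fq i hin y p.1)) p :=
  ((MvPolynomial.hasFDerivAt_eval_pi g p.1).comp p hasFDerivAt_fst).prodMk
    (hasFDerivAt_Emap hin y hq)

theorem IsNonsingularSolution.isIsolatedIn {A n : ℕ} {X : Set (Fin A → ℂ)}
    {fp fq : Fin n → MvPolynomial (Fin A) ℂ} {i : ℕ} {hin : i ≤ n} {y : EmbParam A n → ℂ}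
    {p : (Fin A → ℂ) × (Fin i → ℂ)} (hq : ∀ k, MvPolynomial.eval p.1 (fq k) ≠ 0)
    (hp : IsNonsingularSolution X fp fq i hin y p) :
    IsIsolatedIn (ESol X fp fq i hin y) p := by
  obtain ⟨hpE, g, U, hUo, hpU, hXU, -, hbij⟩ := hp
  refine ⟨hpE, ?_⟩
  have hG := hasFDerivAt_eval_prod_Emap (fp := fp) g hin y hq
  rw [hG.fderiv] at hbij
  obtain ⟨K, -, hK⟩ := LinearMap.exists_antilipschitzWith _ (LinearMap.ker_eq_bot.2 hbij.1)
  have hne := hG.eventually_ne (c := 0) ⟨K, hK⟩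
  rw [eventually_nhdsWithin_iff, eventually_nhds_iff] at hne
  obtain ⟨V, hV, hVo, hpV⟩ := hne
  refine ⟨V ∩ Prod.fst ⁻¹' U, hVo.inter (hUo.preimage continuous_fst), ⟨hpV, hpU⟩, ?_⟩
  refine Set.eq_singleton_iff_unique_mem.2 ⟨⟨hpE, hpV, hpU⟩, ?_⟩
  rintro q ⟨hqE, hqV, hqU⟩
  by_contra hqp
  have hqg : q.1 ∈ X ∩ U := ⟨hqE.1, hqU⟩
  rw [hXU] at hqg
  exact hV q hqV hqp (Prod.ext (funext hqg.2) hqE.2)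

/-- At a singular solution of the embedded system some right-hand side is not attained by the
differential of the system along the tangent space of the manifold. -/
theorem exists_forall_ne_of_not_isNonsingularSolution {A n : ℕ} (hnA : n ≤ A)
    {X : Set (Fin A → ℂ)} {fp fq : Fin n → MvPolynomial (Fin A) ℂ} {i : ℕ} {hin : i ≤ n}
    {y : EmbParam A n → ℂ} {p : (Fin A → ℂ) × (Fin i → ℂ)}
    (hX : IsAffineAlgebraicManifold A n X)
    (hq : ∀ k, MvPolynomial.eval p.1 (fq k) ≠ 0) (hpE : p ∈ ESol X fp fq i hin y)
    (hp : ¬ IsNonsingularSolution X fp fq i hin y p) :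
    ∃ (g : Fin (A - n) → MvPolynomial (Fin A) ℂ) (γ : (Fin n → ℂ) × (Fin i → ℂ)),
      (∀ k, ∀ x ∈ X, MvPolynomial.eval x (g k) = 0) ∧
      ∀ v : (Fin A → ℂ) × (Fin i → ℂ), (∀ k, (g k).evalDeriv p.1 v.1 = 0) →
        EmapDeriv fp fq i hin y p.1 v ≠ γ := by
  obtain ⟨g, U, hUo, hpU, hXU, hrank⟩ := hX.2.2 p.1 hpE.1
  have hgX : ∀ k, ∀ x ∈ X, MvPolynomial.eval x (g k) = 0 := fun k => by
    refine hX.eval_eq_zero (g k) hpE.1 ?_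
    filter_upwards [hUo.mem_nhds hpU] with x hxU hxX
    have hx : x ∈ X ∩ U := ⟨hxX, hxU⟩
    rw [hXU] at hx
    exact hx.2 k
  by_contra! hcon
  refine hp ⟨hpE, g, U, hUo, hpU, hXU, hrank, ?_⟩
  rw [(hasFDerivAt_eval_prod_Emap (fp := fp) g hin y hq).fderiv]
  have hsurj : Function.Surjective (((ContinuousLinearMap.pi fun k => (g k).evalDeriv p.1).comp
        (ContinuousLinearMap.fst ℂ _ _)).prod (EmapDeriv fp fq i hin y p.1)) := by
    rintro ⟨a, γ⟩
    obtain ⟨u, hu⟩ := MvPolynomial.surjective_evalDeriv hrank a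
    obtain ⟨v, hv, hvγ⟩ := hcon g (γ - EmapDeriv fp fq i hin y p.1 (u, 0)) hgX
    refine ⟨(u, 0) + v, ?_⟩
    rw [map_add]
    refine Prod.ext ?_ ?_
    · funext k
      simpa [hv] using congrFun hu k
    · simp [hvγ]
  suffices ∀ L : (Fin A → ℂ) × (Fin i → ℂ) →L[ℂ]
      (Fin (A - n) → ℂ) × ((Fin n → ℂ) × (Fin i → ℂ)), Function.Surjective L →
      Function.Bijective L from this _ hsurj
  refine fun L hL => ⟨(LinearMap.injective_iff_surjective_of_finrank_eq_finrank
    (f := L.toLinearMap) ?_).2 hL, hL⟩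
  simp only [Module.finrank_prod, Module.finrank_fin_fun]
  omega

/-- A derivation modulo `φ` applied to a point moving on `X` gives tangent vectors of `X`. -/
theorem eventually_evalDeriv_eq_zero {W : Type*} {A : ℕ} {X : Set (Fin A → ℂ)} {φ : Filter W}
    {D : (W → ℂ) →ₗ[ℂ] (W → ℂ)}
    (hD : ∀ f g, ∀ᶠ w in φ, D (f * g) w = f w * D g w + g w * D f w)
    (hC : ∀ a : ℂ, D (fun _ => a) = 0) {x : W → Fin A → ℂ} (hx : ∀ w, x w ∈ X) :
    ∀ᶠ w in φ, ∀ P : MvPolynomial (Fin A) ℂ, (∀ a ∈ X, MvPolynomial.eval a P = 0) →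
      P.evalDeriv (x w) (fun t => D (fun w => x w t) w) = 0 := by
  let I := MvPolynomial.vanishingIdeal ℂ X
  have hI : ∀ P, P ∈ I ↔ ∀ a ∈ X, MvPolynomial.eval a P = 0 := fun P => by
    simp [I, MvPolynomial.mem_vanishingIdeal_iff, MvPolynomial.aeval_eq_eval]
  obtain ⟨S, hS⟩ : I.FG := IsNoetherian.noetherian I
  have hSI : ∀ q ∈ S, ∀ a ∈ X, MvPolynomial.eval a q = 0 := fun q hq =>
    (hI q).1 (hS ▸ Ideal.subset_span hq)
  have hev : ∀ᶠ w in φ, ∀ q ∈ S, q.evalDeriv (x w) (fun t => D (fun w => x w t) w) = 0 := by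
    refine (eventually_all_finset S).2 fun q hq => ?_
    filter_upwards [eventually_derivation_eval hD hC x q] with w hw
    rw [MvPolynomial.evalDeriv_apply, ← hw,
      show (fun w => MvPolynomial.eval (x w) q) = fun _ => 0 from
        funext fun w => hSI q hq _ (hx w), hC, Pi.zero_apply]
  filter_upwards [hev] with w hw P hP
  exact MvPolynomial.evalDeriv_eq_zero_of_mem_span (S := S) (fun q hq => hSI q hq _ (hx w)) hw
    (hS ▸ (hI P).2 hP)

theorem eventually_derivation_ratval {W : Type*} {A : ℕ} {φ : Filter W}
    {D : (W → ℂ) →ₗ[ℂ] (W → ℂ)}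
    (hD : ∀ f g, ∀ᶠ w in φ, D (f * g) w = f w * D g w + g w * D f w)
    (hC : ∀ a : ℂ, D (fun _ => a) = 0) {x : W → Fin A → ℂ} (p q : MvPolynomial (Fin A) ℂ)
    (hq : ∀ w, MvPolynomial.eval (x w) q ≠ 0) :
    ∀ᶠ w in φ, D (fun w => ratval p q (x w)) w =
      ratDeriv p q (x w) (fun t => D (fun w => x w t) w) := by
  have hmul : (fun w => MvPolynomial.eval (x w) q) * (fun w => ratval p q (x w)) =
      fun w => MvPolynomial.eval (x w) p := by
    funext w
    simp [ratval, mul_div_cancel₀ _ (hq w)]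
  filter_upwards [eventually_derivation_eval hD hC x p, eventually_derivation_eval hD hC x q,
    hD (fun w => MvPolynomial.eval (x w) q) (fun w => ratval p q (x w))] with w hp hq' hw
  rw [hmul, hp, hq', ← MvPolynomial.evalDeriv_apply, ← MvPolynomial.evalDeriv_apply] at hw
  simp only [ratDeriv, smul_apply, sub_apply, smul_eq_mul, hw]
  field_simp [hq w]
  ring

theorem eventually_derivation_sum_mul {W ι : Type*} [Fintype ι] {φ : Filter W}
    {D : (W → ℂ) →ₗ[ℂ] (W → ℂ)}
    (hD : ∀ f g, ∀ᶠ w in φ, D (f * g) w = f w * D g w + g w * D f w) (a b : W → ι → ℂ) :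
    ∀ᶠ w in φ, D (fun w => ∑ s, a w s * b w s) w =
      ∑ s, a w s * D (fun w => b w s) w + ∑ s, b w s * D (fun w => a w s) w := by
  have hsum : (fun w => ∑ s, a w s * b w s) = ∑ s, (fun w => a w s) * (fun w => b w s) := by
    funext w
    simp
  filter_upwards [eventually_all.2 fun s => hD (fun w => a w s) (fun w => b w s)] with w hw
  rw [hsum, map_sum, Finset.sum_apply, ← Finset.sum_add_distrib]
  exact Finset.sum_congr rfl fun s _ => hw s

/-- The parameters of the embedded system `E_i(f)` at which it has a singular solution with
`z ≠ 0` all lie on a hypersurface of the parameter space. -/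
theorem exists_ne_zero_forall_isNonsingularSolution {A n : ℕ} (hnA : n ≤ A)
    {X : Set (Fin A → ℂ)} (hX : IsAffineAlgebraicManifold A n X)
    (fp fq : Fin n → MvPolynomial (Fin A) ℂ)
    (hq : ∀ k, ∀ x ∈ X, MvPolynomial.eval x (fq k) ≠ 0) (i : ℕ) (hin : i ≤ n) :
    ∃ P : MvPolynomial (EmbParam A n) ℂ, P ≠ 0 ∧ ∀ y, MvPolynomial.eval y P ≠ 0 →
      ∀ p ∈ ESol X fp fq i hin y, p.2 ≠ 0 → IsNonsingularSolution X fp fq i hin y p := by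
  by_contra! hcon
  let W := {w : (EmbParam A n → ℂ) × ((Fin A → ℂ) × (Fin i → ℂ)) //
    w.2 ∈ ESol X fp fq i hin w.1 ∧ w.2.2 ≠ 0 ∧ ¬ IsNonsingularSolution X fp fq i hin w.1 w.2}
  let y : W → EmbParam A n → ℂ := fun w => w.1.1
  let x : W → Fin A → ℂ := fun w => w.1.2.1
  let z : W → Fin i → ℂ := fun w => w.1.2.2
  have hxX : ∀ w, x w ∈ X := fun w => w.2.1.1
  have hqx : ∀ k w, MvPolynomial.eval (x w) (fq k) ≠ 0 := fun k w => hq k _ (hxX w)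
  choose g γ hg hγ using fun w : W =>
    exists_forall_ne_of_not_isNonsingularSolution hnA hX (fun k => hqx k w) w.2.1 w.2.2.2
  obtain ⟨φ, hφ⟩ := exists_generic_ultrafilter y fun P hP => by
    obtain ⟨y', hy', p, hp, hp0, hps⟩ := hcon P hP
    exact ⟨⟨(y', p), hp, hp0, hps⟩, hy'⟩
  obtain ⟨j₀, hj₀⟩ : ∃ j₀, ∀ᶠ w in φ, z w j₀ ≠ 0 := by
    by_contra! hz
    obtain ⟨w, hw⟩ := (eventually_all.2 hz).exists
    exact w.2.2.1 (funext hw)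
  let c : W → EmbParam A n → ℂ := fun w => Sum.elim
    (fun s => if h : s.2 = 0 ∧ s.1.1 < i then -(γ w).2 ⟨s.1.1, h.2⟩ else 0)
    (fun s => if s.2 = j₀.castLE hin then -(γ w).1 s.1 / z w j₀ else 0)
  obtain ⟨D, hD, hC, hDy⟩ := φ.exists_derivation y hφ c
  have hf : ∀ k w, ratval (fp k) (fq k) (x w) +
      ∑ j : Fin i, y w (Sum.inr (k, j.castLE hin)) * z w j = 0 := fun k w =>
    congrFun (congrArg Prod.fst w.2.1.2) k
  have hl : ∀ j w, y w (Sum.inl (Fin.castLE hin j, 0)) +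
      ∑ t : Fin A, y w (Sum.inl (Fin.castLE hin j, t.succ)) * x w t + z w j = 0 := fun j w =>
    congrFun (congrArg Prod.snd w.2.1.2) j
  have hDf : ∀ k, D (fun w => ratval (fp k) (fq k) (x w)) +
      D (fun w => ∑ j : Fin i, y w (Sum.inr (k, j.castLE hin)) * z w j) = 0 := fun k => by
    rw [← map_add, ← map_zero D]
    exact congrArg D (funext (hf k))
  have hDl : ∀ j, D (fun w => y w (Sum.inl (Fin.castLE hin j, 0))) +
      D (fun w => ∑ t : Fin A, y w (Sum.inl (Fin.castLE hin j, t.succ)) * x w t) +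
      D (fun w => z w j) = 0 := fun j => by
    rw [← map_add, ← map_add, ← map_zero D]
    exact congrArg D (funext (hl j))
  obtain ⟨w, hw₀, hwy, hwX, hwr, hwf, hwl⟩ := (hj₀.and <| (eventually_all.2 hDy).and <|
    (eventually_evalDeriv_eq_zero hD hC hxX).and <|
    (eventually_all.2 fun k => eventually_derivation_ratval hD hC (fp k) (fq k) (hqx k)).and <|
    (eventually_all.2 fun k => eventually_derivation_sum_mul hD
      (fun w (j : Fin i) => y w (Sum.inr (k, j.castLE hin))) z).and <|
    (eventually_all.2 fun j => eventually_derivation_sum_mul hD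
      (fun w (t : Fin A) => y w (Sum.inl (Fin.castLE hin j, t.succ))) x)).exists
  refine hγ w (fun t => D (fun w => x w t) w, fun j => D (fun w => z w j) w)
    (fun k => hwX _ (hg w k)) ?_
  rw [EmapDeriv_apply]
  refine Prod.ext (funext fun k => ?_) (funext fun j => ?_)
  · have h := congrFun (hDf k) w
    have hsum : ∑ j : Fin i, z w j * c w (Sum.inr (k, j.castLE hin)) = -(γ w).1 k := by
      simp [c, mul_div_cancel₀ _ hw₀]
    simp only [Pi.add_apply, Pi.zero_apply, hwr, hwf, hwy, hsum] at h
    simp only [lamval]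
    linear_combination h
  · have h := congrFun (hDl j) w
    simp only [Pi.add_apply, Pi.zero_apply, hwl, hwy] at h
    simp [c] at h
    linear_combination h

/-- Let `f = (f_1, …, f_n)` be a system of `n` algebraic (rational, with
nonvanishing denominators) functions on a connected `n`-dimensional algebraic
manifold `X` embedded in `ℂ^A`, and for `i = 1, …, n` let `E_i(f)` be the embedded
system in the variables `(x, z_1, …, z_i)` consisting of
`f_k(x) + Σ_{j=1}^{i} λ_{k,j} z_j = 0` (k = 1, …, n) and
`a_j + a_{j,1} x_1 + ⋯ + a_{j,A} x_A + z_j = 0` (j = 1, …, i).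
Then there is a nonempty Zariski open set `U` of parameter values
`(a_j, a_{j,k}, λ_{k,j}) ∈ ℂ^{n×(A+1)} × ℂ^{n×n}` such that for every choice of
parameters in `U` and every `i = 1, …, n`, all solutions of
`E_i(x, z_1, …, z_i) = 0` with `(z_1, …, z_i) ≠ 0` are isolated and nonsingular. -/
theorem embedding_solutions_isolated_nonsingular (A n : ℕ) (hn : 0 < n) (hnA : n ≤ A)
    (X : Set (Fin A → ℂ)) (hX : IsAffineAlgebraicManifold A n X)
    (fp fq : Fin n → MvPolynomial (Fin A) ℂ)
    (hq : ∀ k, ∀ x ∈ X, MvPolynomial.eval x (fq k) ≠ 0) :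
    ∃ U : Set (EmbParam A n → ℂ), IsZariskiOpen U ∧ U.Nonempty ∧
      ∀ y ∈ U, ∀ (i : ℕ) (hi1 : 1 ≤ i) (hin : i ≤ n),
        ∀ p ∈ ESol X fp fq i hin y, p.2 ≠ 0 →
          IsIsolatedIn (ESol X fp fq i hin y) p ∧
          IsNonsingularSolution X fp fq i hin y p := by
  choose P hP hPns using fun i : Fin (n + 1) =>
    exists_ne_zero_forall_isNonsingularSolution hnA hX fp fq hq i (Nat.le_of_lt_succ i.2)
  have hne : ∏ i, P i ≠ 0 := Finset.prod_ne_zero_iff.2 fun i _ => hP i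
  refine ⟨{y | MvPolynomial.eval y (∏ i, P i) ≠ 0}, ⟨{∏ i, P i}, ?_⟩, ?_, ?_⟩
  · ext y
    simp [zlocus]
  · by_contra! hempty
    refine hne (MvPolynomial.funext fun y => ?_)
    by_contra hy
    exact (Set.ext_iff.1 hempty y).1 (by simpa using hy)
  · intro y hy i _ hin p hp hp0
    have hyi : MvPolynomial.eval y (P ⟨i, Nat.lt_succ_of_le hin⟩) ≠ 0 := by
      rw [Set.mem_ofPred_eq, map_prod] at hy
      exact Finset.prod_ne_zero_iff.1 hy _ (Finset.mem_univ _)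
    have hns := hPns ⟨i, Nat.lt_succ_of_le hin⟩ y hyi p hp hp0
    exact ⟨hns.isIsolatedIn fun k => hq k _ hp.1, hns⟩
end

section
/- Let f = (f_1, ..., f_n) be a system of n algebraic functions on a connected n-dimensional algebraic manifold X embedded in ℂ^A, and for i = 1, ..., n let E_i(f) denote the embedded system in variables (x, z_1, ..., z_i) consisting of the equations f_k(x) + Σ_{j=1}^{i} λ_{k,j} z_j = 0 for k = 1, ..., n together with the linear slicing equations a_j + a_{j,1} x_1 + ... + a_{j,A} x_A + z_j = 0 for j = 1, ..., i. Then there is a nonempty Zariski open set U of parameter values in ℂ^{n×(A+1)} × ℂ^{n×n} such that for each i = 1, ..., n, the set of solutions of E_i(x, z_1, ..., z_i) = 0 with (z_1, ..., z_i) ≠ 0 coincides with the set of solutions of E_i(x, z_1, ..., z_i) = 0 with z_i ≠ 0. -/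
set_option synthInstance.maxHeartbeats 1000000
set_option maxHeartbeats 1000000

open Filter Topology

open MvPolynomial in
theorem exists_vanishing_or_generic_lift {σ τ : Type*} [Finite σ] [Finite τ]
    (T : Set (MvPolynomial (σ ⊕ τ) ℂ)) :
    (∃ g : MvPolynomial σ ℂ, g ≠ 0 ∧ ∀ y w, Sum.elim y w ∈ zlocus T → eval y g = 0) ∨
    (∃ g : MvPolynomial σ ℂ, g ≠ 0 ∧
      ∀ y, eval y g ≠ 0 → ∃ w, Sum.elim y w ∈ zlocus T) := by
  set I := Ideal.span T
  let φ : MvPolynomial σ ℂ →+* MvPolynomial (σ ⊕ τ) ℂ ⧸ I :=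
    (Ideal.Quotient.mk I).comp (rename Sum.inl).toRingHom
  have hφ (p : MvPolynomial σ ℂ) : φ p = Ideal.Quotient.mk I (rename Sum.inl p) := rfl
  by_cases hinj : Function.Injective φ
  · right
    have hft : φ.FiniteType := by
      have hc : φ.comp C = algebraMap ℂ (MvPolynomial (σ ⊕ τ) ℂ ⧸ I) := by
        ext c
        simp [hφ]
        rfl
      refine RingHom.FiniteType.of_comp_finiteType (f := C) ?_
      rw [hc, RingHom.finiteType_algebraMap]
      infer_instance
    have hcons := PrimeSpectrum.isConstructible_range_comap
      (RingHom.FinitePresentation.of_finiteType.mp hft)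
    obtain ⟨S, hS⟩ := PrimeSpectrum.exists_constructibleSetData_iff.mpr hcons
    obtain ⟨q, hq, hq0⟩ := Ideal.exists_comap_eq_of_mem_minimalPrimes_of_injective hinj
      (⊥ : Ideal (MvPolynomial σ ℂ)) (by simp [IsDomain.minimalPrimes_eq_singleton_bot])
    have hbot : (⊥ : PrimeSpectrum (MvPolynomial σ ℂ)) ∈ S.toSet := by
      rw [hS]
      exact ⟨⟨q, hq⟩, PrimeSpectrum.ext hq0⟩
    simp only [PrimeSpectrum.ConstructibleSetData.toSet, Set.mem_iUnion] at hbot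
    obtain ⟨D, hDS, hD⟩ := hbot
    have hDg (k) : D.g k = 0 := hD.1 ⟨k, rfl⟩
    refine ⟨D.f, fun h0 => hD.2 (by simp [h0]), fun y hy => ?_⟩
    have hprime : (RingHom.ker (eval y)).IsPrime := RingHom.ker_isPrime _
    have hyS : (⟨RingHom.ker (eval y), hprime⟩ : PrimeSpectrum (MvPolynomial σ ℂ)) ∈ S.toSet := by
      refine Set.mem_biUnion hDS ⟨?_, fun h => hy (by simpa using h)⟩
      rintro _ ⟨k, rfl⟩
      simp [hDg]
    rw [hS] at hyS
    obtain ⟨Q, hQ⟩ := hyS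
    have hQ' : Q.asIdeal.comap φ = RingHom.ker (eval y) := congrArg PrimeSpectrum.asIdeal hQ
    obtain ⟨M, hM, hQM⟩ := Ideal.exists_le_maximal
      (Q.asIdeal.comap (Ideal.Quotient.mk I)) (Ideal.IsPrime.ne_top inferInstance)
    obtain ⟨x, rfl⟩ := eq_vanishingIdeal_singleton_of_isMaximal ℂ hM
    have hx : ∀ i, x (Sum.inl i) = y i := by
      intro i
      have h1 : X i - C (y i) ∈ Q.asIdeal.comap φ := by simp [hQ', RingHom.mem_ker]
      have h2 := hQM (show rename Sum.inl (X i - C (y i)) ∈ _ from h1)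
      simpa [mem_vanishingIdeal_singleton_iff, sub_eq_zero] using h2
    refine ⟨x ∘ Sum.inr, fun p hp => ?_⟩
    have hxe : Sum.elim y (x ∘ Sum.inr) = x := by
      ext (i | i) <;> simp [hx]
    have h3 : p ∈ Q.asIdeal.comap (Ideal.Quotient.mk I) := by
      rw [Ideal.mem_comap, Ideal.Quotient.eq_zero_iff_mem.mpr (Ideal.subset_span hp)]
      exact zero_mem _
    simpa [hxe, mem_vanishingIdeal_singleton_iff, aeval_eq_eval] using hQM h3
  · left
    rw [injective_iff_map_eq_zero] at hinj
    push Not at hinj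
    obtain ⟨g, hg, hg0⟩ := hinj
    refine ⟨g, hg0, fun y w hyw => ?_⟩
    rw [hφ, Ideal.Quotient.eq_zero_iff_mem] at hg
    have hle : I ≤ RingHom.ker (eval (Sum.elim y w)) := Ideal.span_le.mpr hyw
    simpa [RingHom.mem_ker, eval_rename] using hle hg

theorem dimH_le_of_locally_submersive {E F : Type*} [NormedAddCommGroup E] [NormedSpace ℂ E]
    [FiniteDimensional ℂ E] [NormedAddCommGroup F] [NormedSpace ℂ F] [FiniteDimensional ℂ F]
    {Z : Set E} {d : ℕ} (hd : Module.finrank ℂ F + d = Module.finrank ℂ E)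
    (h : ∀ p ∈ Z, ∃ (H : E → F) (H' : E →L[ℂ] F), HasStrictFDerivAt H H' p ∧
      Function.Surjective H' ∧ ∀ᶠ q in 𝓝[Z] p, H q = 0) :
    dimH Z ≤ (2 * d : ℕ) := by
  by_contra! hlt
  obtain ⟨p, hpZ, hp⟩ := exists_mem_nhdsWithin_lt_dimH_of_lt_dimH hlt
  obtain ⟨H, H', hH, hsurj, hzero⟩ := h p hpZ
  have : CompleteSpace E := FiniteDimensional.complete ℂ E
  have hr : H'.range = ⊤ := LinearMap.range_eq_top.mpr hsurj
  have hp0 : H p = 0 := hzero.self_of_nhdsWithin hpZ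
  obtain ⟨K, s, hs, hlip⟩ := (hH.to_implicitFunction hr).exists_lipschitzOnWith
  set Φ := hH.implicitToOpenPartialHomeomorph H H' hr
  have hsnd : Tendsto (fun x => (Φ x).2) (𝓝 p) (𝓝 0) := by
    have hc := Φ.continuousAt (hH.mem_implicitToOpenPartialHomeomorph_source hr)
    have h2 := (continuous_snd.tendsto _).comp hc.tendsto
    simpa [Φ, Function.comp_def] using h2
  have hmem : hH.implicitFunction H H' hr (H p) '' s ∈ 𝓝[Z] p := by
    filter_upwards [hzero, mem_nhdsWithin_of_mem_nhds (hH.eq_implicitFunction hr),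
      mem_nhdsWithin_of_mem_nhds (hsnd hs)] with x hx0 hx hxs
    refine ⟨_, hxs, ?_⟩
    rw [hp0, ← hx0]
    exact hx
  refine (hp _ hmem).not_ge ((hlip.dimH_image_le).trans ((dimH_mono (Set.subset_univ s)).trans ?_))
  have : FiniteDimensional ℝ H'.ker := FiniteDimensional.complexToReal _
  rw [Real.dimH_univ_eq_finrank, finrank_real_of_complex]
  have hk := LinearMap.finrank_range_add_finrank_ker (H' : E →ₗ[ℂ] F)
  rw [LinearMap.range_eq_top.mpr hsurj, finrank_top] at hk
  have hkd : Module.finrank ℂ H'.ker = d := by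
    have : Module.finrank ℂ H'.ker = Module.finrank ℂ (LinearMap.ker (H' : E →ₗ[ℂ] F)) := rfl
    omega
  rw [hkd]

theorem hasStrictFDerivAt_eval {σ : Type*} [Fintype σ] (p : MvPolynomial σ ℂ) (x : σ → ℂ) :
    HasStrictFDerivAt (fun z : σ → ℂ => MvPolynomial.eval z p)
      (∑ t, MvPolynomial.eval x (MvPolynomial.pderiv t p) •
        ContinuousLinearMap.proj (R := ℂ) (φ := fun _ : σ => ℂ) t) x := by
  classical
  induction p using MvPolynomial.induction_on with
  | C a =>
    simp only [MvPolynomial.eval_C]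
    exact (hasStrictFDerivAt_const a x).congr_fderiv (by ext v; simp)
  | add p q hp hq =>
    simp only [MvPolynomial.eval_add]
    exact (hp.fun_add hq).congr_fderiv
      (by ext v; simp [MvPolynomial.eval_add, add_mul, Finset.sum_add_distrib])
  | mul_X p i hp =>
    simp only [MvPolynomial.eval_mul, MvPolynomial.eval_X]
    refine (hp.fun_mul
      (ContinuousLinearMap.proj (R := ℂ) (φ := fun _ : σ => ℂ) i).hasStrictFDerivAt).congr_fderiv ?_
    ext v
    simp [MvPolynomial.pderiv_X, Pi.single_apply, Finset.sum_add_distrib, Finset.mul_sum, add_mul,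
      apply_ite (MvPolynomial.eval x), mul_assoc]

theorem Matrix.mulVec_surjective_of_rank_eq {m : ℕ} {ι : Type*} [Fintype ι] [DecidableEq ι]
    {M : Matrix (Fin m) ι ℂ} (h : M.rank = m) : Function.Surjective M.mulVec := by
  refine LinearMap.range_eq_top (f := M.mulVecLin) |>.mp ?_
  apply Submodule.eq_top_of_finrank_eq
  simpa [Matrix.rank] using h

/-- The parameters for which some `x ∈ X` satisfies `L_e(x) = 0`, `L_{j₀}(x) ≠ 0` and
`f_k(x) = ∑_{j < e} λ_{k,j} L_j(x)` for all `k`. -/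
def degenerateParams {A n : ℕ} (X : Set (Fin A → ℂ)) (fp fq : Fin n → MvPolynomial (Fin A) ℂ)
    (e j₀ : Fin n) : Set (EmbParam A n → ℂ) :=
  {y | ∃ x ∈ X, Lval y e x = 0 ∧ Lval y j₀ x ≠ 0 ∧
    ∀ k, MvPolynomial.eval x (fp k) -
      MvPolynomial.eval x (fq k) * ∑ j with j < e, lamval y k j * Lval y j x = 0}

/-- The map whose zeros, away from `L_{j₀}(x) = 0`, lie over the degenerate parameters. -/
noncomputable def sliceMap {A n : ℕ} (fp fq : Fin n → MvPolynomial (Fin A) ℂ) (e : Fin n)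
    (q : (Fin A → ℂ) × (EmbParam A n → ℂ)) : (Fin n → ℂ) × ℂ :=
  (fun k => MvPolynomial.eval q.1 (fp k) -
      MvPolynomial.eval q.1 (fq k) * ∑ j with j < e, lamval q.2 k j * Lval q.2 j q.1,
    Lval q.2 e q.1)

theorem contDiff_sliceMap {A n : ℕ} (fp fq : Fin n → MvPolynomial (Fin A) ℂ) (e : Fin n) :
    ContDiff ℂ 1 (sliceMap fp fq e) := by
  have hev (p : MvPolynomial (Fin A) ℂ) :
      ContDiff ℂ 1 fun x : Fin A → ℂ => MvPolynomial.eval x p :=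
    contDiffOn_univ.mp (AnalyticOnNhd.eval_mvPolynomial p).contDiffOn_of_completeSpace
  have h1 (p : MvPolynomial (Fin A) ℂ) :
      ContDiff ℂ 1 fun q : (Fin A → ℂ) × (EmbParam A n → ℂ) => MvPolynomial.eval q.1 p :=
    (hev p).comp contDiff_fst
  unfold sliceMap Lval lamval
  fun_prop

theorem exists_sliceMap_line {A n : ℕ} (fp fq : Fin n → MvPolynomial (Fin A) ℂ) {e j₀ : Fin n}
    (hj : j₀ < e) {x : Fin A → ℂ} {y : EmbParam A n → ℂ} (hL : Lval y j₀ x ≠ 0)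
    (hq : ∀ k, MvPolynomial.eval x (fq k) ≠ 0) (c : (Fin n → ℂ) × ℂ) :
    ∃ t : EmbParam A n → ℂ, ∀ s : ℂ,
      sliceMap fp fq e (x, y + s • t) = sliceMap fp fq e (x, y) + s • c := by
  let b : Fin n → ℂ := fun k => -c.1 k / (MvPolynomial.eval x (fq k) * Lval y j₀ x)
  let t : EmbParam A n → ℂ := Sum.elim (fun a => if a = (e, 0) then c.2 else 0)
    (fun a => if a.2 = j₀ then b a.1 else 0)
  have hLv (s : ℂ) (j : Fin n) :
      Lval (y + s • t) j x = Lval y j x + s * if j = e then c.2 else 0 := by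
    have h0 (u : Fin A) : t (Sum.inl (j, u.succ)) = 0 := by simp [t, Fin.succ_ne_zero]
    simp only [Lval, Pi.add_apply, Pi.smul_apply, h0]
    simp [t]
    ring
  have hlam (s : ℂ) (k j : Fin n) :
      lamval (y + s • t) k j = lamval y k j + s * if j = j₀ then b k else 0 := by
    simp [lamval, t]
  refine ⟨t, fun s => Prod.ext (funext fun k => ?_) ?_⟩
  · have hsum : ∑ j with j < e, lamval (y + s • t) k j * Lval (y + s • t) j x =
        (∑ j with j < e, lamval y k j * Lval y j x) + s * b k * Lval y j₀ x := by
      have h1 : ∑ j with j < e, (if j = j₀ then s * b k * Lval y j x else 0) =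
          s * b k * Lval y j₀ x := by
        rw [Finset.sum_ite_eq' (Finset.univ.filter (· < e)) j₀]
        simp [hj]
      rw [← h1, ← Finset.sum_add_distrib]
      refine Finset.sum_congr rfl fun j hje => ?_
      rw [hLv, hlam, if_neg (Finset.mem_filter.mp hje).2.ne]
      split_ifs <;> ring
    simp only [sliceMap, hsum, Prod.fst_add, Prod.smul_fst, Pi.add_apply, Pi.smul_apply, b,
      smul_eq_mul]
    have := hq k
    field_simp
    ring
  · simp [sliceMap, hLv]

theorem dimH_degenerateParams_le {A n : ℕ} (hnA : n ≤ A) {X : Set (Fin A → ℂ)}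
    (hX : IsAffineAlgebraicManifold A n X) {fp fq : Fin n → MvPolynomial (Fin A) ℂ}
    (hq : ∀ k, ∀ x ∈ X, MvPolynomial.eval x (fq k) ≠ 0) {e j₀ : Fin n} (hj : j₀ < e) :
    dimH (degenerateParams X fp fq e j₀) ≤ (2 * (Fintype.card (EmbParam A n) - 1) : ℕ) := by
  let Z : Set ((Fin A → ℂ) × (EmbParam A n → ℂ)) :=
    {q | q.1 ∈ X ∧ Lval q.2 j₀ q.1 ≠ 0 ∧ sliceMap fp fq e q = 0}
  have hsub : degenerateParams X fp fq e j₀ ⊆ Prod.snd '' Z := by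
    rintro y ⟨x, hx, he, h0, hk⟩
    exact ⟨(x, y), ⟨hx, h0, Prod.ext (funext hk) he⟩, rfl⟩
  refine (dimH_mono hsub).trans ((LipschitzWith.prod_snd.dimH_image_le Z).trans ?_)
  have hcard : 0 < Fintype.card (EmbParam A n) := Fintype.card_pos_iff.mpr ⟨Sum.inr (e, e)⟩
  refine dimH_le_of_locally_submersive (F := (Fin (A - n) → ℂ) × ((Fin n → ℂ) × ℂ)) ?_ ?_
  · simp only [Module.finrank_prod, Module.finrank_fintype_fun_eq_card, Fintype.card_fin,
      Module.finrank_self]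
    omega
  rintro ⟨x, y⟩ ⟨hx, h0, hS⟩
  obtain ⟨g, U, hU, hxU, hXU, hrank⟩ := hX.2.2 x hx
  let g' : (Fin A → ℂ) →L[ℂ] (Fin (A - n) → ℂ) := ContinuousLinearMap.pi fun k =>
    ∑ t, MvPolynomial.eval x (MvPolynomial.pderiv t (g k)) •
        ContinuousLinearMap.proj (R := ℂ) (φ := fun _ : Fin A => ℂ) t
  have hg' : HasStrictFDerivAt (fun z : Fin A → ℂ => fun k => MvPolynomial.eval z (g k)) g' x :=
    hasStrictFDerivAt_pi.mpr fun k => hasStrictFDerivAt_eval (g k) x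
  have hg'surj : Function.Surjective g' := by
    intro c
    obtain ⟨v, hv⟩ := Matrix.mulVec_surjective_of_rank_eq hrank c
    refine ⟨v, ?_⟩
    rw [← hv]
    ext k
    simp [g', Matrix.mulVec, dotProduct]
  have hs := (contDiff_sliceMap fp fq e).contDiffAt (x := (x, y)) |>.hasStrictFDerivAt one_ne_zero
  set S' := fderiv ℂ (sliceMap fp fq e) (x, y)
  have hdir (c) : ∃ t, S' (0, t) = c := by
    obtain ⟨t, ht⟩ := exists_sliceMap_line fp fq hj h0 (fun k => hq k x hx) c
    refine ⟨t, ?_⟩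
    have h1 : HasDerivAt (fun s : ℂ => sliceMap fp fq e ((x, y) + s • (0, t))) (S' (0, t)) 0 :=
      hs.hasFDerivAt.hasLineDerivAt (0, t)
    have h2 : HasDerivAt (fun s : ℂ => sliceMap fp fq e ((x, y) + s • (0, t))) c 0 := by
      have h3 : (fun s : ℂ => sliceMap fp fq e ((x, y) + s • (0, t))) =
          fun s : ℂ => sliceMap fp fq e (x, y) + s • c := by
        funext s
        rw [← ht s]
        simp
      rw [h3]
      simpa using ((hasDerivAt_id (0 : ℂ)).smul_const c).const_add (sliceMap fp fq e (x, y))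
    exact h1.unique h2
  refine ⟨fun q => (fun k => MvPolynomial.eval q.1 (g k), sliceMap fp fq e q),
    (g'.comp (ContinuousLinearMap.fst ℂ _ _)).prod S',
    (HasStrictFDerivAt.comp (x, y) hg' hasStrictFDerivAt_fst).prodMk hs, ?_, ?_⟩
  · rintro ⟨u, v⟩
    obtain ⟨dx, hdx⟩ := hg'surj u
    obtain ⟨t, ht⟩ := hdir (v - S' (dx, 0))
    refine ⟨(dx, t), Prod.ext hdx ?_⟩
    have : ((dx, t) : (Fin A → ℂ) × (EmbParam A n → ℂ)) = (dx, 0) + (0, t) := by simp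
    change S' (dx, t) = v
    rw [this, map_add, ht, add_sub_cancel]
  · filter_upwards [self_mem_nhdsWithin,
      mem_nhdsWithin_of_mem_nhds ((hU.preimage continuous_fst).mem_nhds hxU)] with q hqZ hqU
    have hmem : q.1 ∈ X ∩ U := ⟨hqZ.1, hqU⟩
    rw [hXU] at hmem
    exact Prod.ext (funext hmem.2) hqZ.2.2

open MvPolynomial in
theorem exists_polynomials_degenerateParams {A n : ℕ} {X : Set (Fin A → ℂ)} (hX : IsAlgSet X)
    (fp fq : Fin n → MvPolynomial (Fin A) ℂ) (e j₀ : Fin n) :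
    ∃ T : Set (MvPolynomial (EmbParam A n ⊕ (Fin A ⊕ Unit)) ℂ), ∀ y,
      (∃ w, Sum.elim y w ∈ zlocus T) ↔ y ∈ degenerateParams X fp fq e j₀ := by
  obtain ⟨S, rfl⟩ := hX
  let R := MvPolynomial (EmbParam A n ⊕ (Fin A ⊕ Unit)) ℂ
  let ι : MvPolynomial (Fin A) ℂ → R := rename (Sum.inr ∘ Sum.inl)
  let L : Fin n → R := fun j => X (Sum.inl (Sum.inl (j, 0))) +
    ∑ t : Fin A, X (Sum.inl (Sum.inl (j, t.succ))) * X (Sum.inr (Sum.inl t))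
  let G : Fin n → R := fun k =>
    ι (fp k) - ι (fq k) * ∑ j with j < e, X (Sum.inl (Sum.inr (k, j))) * L j
  have hι (y w p) : eval (Sum.elim y w) (ι p) = eval (w ∘ Sum.inl) p := by
    simp only [ι, eval_rename]
    rfl
  have hL (y w j) : eval (Sum.elim y w) (L j) = Lval y j (w ∘ Sum.inl) := by simp [L, Lval]
  have hG (y w k) : eval (Sum.elim y w) (G k) = eval (w ∘ Sum.inl) (fp k) -
      eval (w ∘ Sum.inl) (fq k) *
        ∑ j with j < e, lamval y k j * Lval y j (w ∘ Sum.inl) := by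
    simp [G, hι, hL, lamval]
  refine ⟨ι '' S ∪ Set.range G ∪ {L e, X (Sum.inr (Sum.inr ())) * L j₀ - 1}, fun y => ?_⟩
  have key (w) : Sum.elim y w ∈ zlocus
      (ι '' S ∪ Set.range G ∪ {L e, X (Sum.inr (Sum.inr ())) * L j₀ - 1}) ↔
      w ∘ Sum.inl ∈ zlocus S ∧ Lval y e (w ∘ Sum.inl) = 0 ∧
        w (Sum.inr ()) * Lval y j₀ (w ∘ Sum.inl) = 1 ∧
        ∀ k, eval (w ∘ Sum.inl) (fp k) - eval (w ∘ Sum.inl) (fq k) *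
          ∑ j with j < e, lamval y k j * Lval y j (w ∘ Sum.inl) = 0 := by
    simp only [zlocus, Set.mem_ofPred_eq, Set.mem_union, or_imp, forall_and, Set.forall_mem_image,
      Set.forall_mem_range, hι, hG, Set.mem_insert_iff, Set.mem_singleton_iff, forall_eq, hL,
      map_sub, map_mul, eval_X, Sum.elim_inr, map_one, sub_eq_zero]
    tauto
  constructor
  · rintro ⟨w, hw⟩
    obtain ⟨h1, h2, h3, h4⟩ := (key w).mp hw
    exact ⟨_, h1, h2, right_ne_zero_of_mul_eq_one h3, h4⟩
  · rintro ⟨x, h1, h2, h3, h4⟩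
    exact ⟨Sum.elim x fun _ => (Lval y j₀ x)⁻¹, (key _).mpr ⟨h1, h2, inv_mul_cancel₀ h3, h4⟩⟩

theorem exists_vanishing_degenerateParams {A n : ℕ} (hnA : n ≤ A) {X : Set (Fin A → ℂ)}
    (hX : IsAffineAlgebraicManifold A n X) {fp fq : Fin n → MvPolynomial (Fin A) ℂ}
    (hq : ∀ k, ∀ x ∈ X, MvPolynomial.eval x (fq k) ≠ 0) {e j₀ : Fin n} (hj : j₀ < e) :
    ∃ g : MvPolynomial (EmbParam A n) ℂ, g ≠ 0 ∧
      ∀ y ∈ degenerateParams X fp fq e j₀, MvPolynomial.eval y g = 0 := by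
  obtain ⟨T, hT⟩ := exists_polynomials_degenerateParams hX.1 fp fq e j₀
  obtain ⟨g, hg, h⟩ | ⟨g, hg, h⟩ := exists_vanishing_or_generic_lift T
  · refine ⟨g, hg, fun y hy => ?_⟩
    obtain ⟨w, hw⟩ := (hT y).mpr hy
    exact h y w hw
  · exfalso
    have hdim : dimH (degenerateParams X fp fq e j₀) <
        Module.finrank ℝ (EmbParam A n → ℂ) := by
      refine (dimH_degenerateParams_le hnA hX hq hj).trans_lt ?_
      rw [finrank_real_of_complex, Module.finrank_fintype_fun_eq_card, Nat.cast_lt]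
      have hcard : 0 < Fintype.card (EmbParam A n) := Fintype.card_pos_iff.mpr ⟨Sum.inr (e, e)⟩
      omega
    have hopen : IsOpen {y : EmbParam A n → ℂ | MvPolynomial.eval y g ≠ 0} :=
      isOpen_ne_fun (MvPolynomial.continuous_eval g) continuous_const
    have hne : {y : EmbParam A n → ℂ | MvPolynomial.eval y g ≠ 0}.Nonempty := by
      by_contra hempty
      refine hg (MvPolynomial.funext fun y => ?_)
      by_contra hy
      exact hempty ⟨y, by simpa using hy⟩
    obtain ⟨y, hy, hyc⟩ := (dense_compl_of_dimH_lt_finrank hdim).inter_open_nonempty _ hopen hne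
    exact hyc ((hT y).mp (h y hy))

theorem mem_degenerateParams_of_last_eq_zero {A n : ℕ} {X : Set (Fin A → ℂ)}
    {fp fq : Fin n → MvPolynomial (Fin A) ℂ}
    (hq : ∀ k, ∀ x ∈ X, MvPolynomial.eval x (fq k) ≠ 0) {i : ℕ} (hin : i ≤ n)
    {y : EmbParam A n → ℂ} {p : (Fin A → ℂ) × (Fin i → ℂ)} (hp : p ∈ ESol X fp fq i hin y)
    {l j₀ : Fin i} (hl : (l : ℕ) + 1 = i) (hpl : p.2 l = 0) (hpj : p.2 j₀ ≠ 0) :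
    j₀ < l ∧ y ∈ degenerateParams X fp fq (l.castLE hin) (j₀.castLE hin) := by
  obtain ⟨hx, hE⟩ := hp
  have hf (k) : ratval (fp k) (fq k) p.1 + ∑ j : Fin i, lamval y k (j.castLE hin) * p.2 j = 0 :=
    congrFun (congrArg Prod.fst hE) k
  have hz (j : Fin i) : p.2 j = -Lval y (j.castLE hin) p.1 := by
    have : Lval y (j.castLE hin) p.1 + p.2 j = 0 := congrFun (congrArg Prod.snd hE) j
    linear_combination this
  have hjl : j₀ < l := by
    have : j₀ ≠ l := fun h => hpj (h ▸ hpl)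
    omega
  refine ⟨hjl, p.1, hx, ?_, ?_, fun k => ?_⟩
  · simpa [hz] using hpl
  · simpa [hz] using hpj
  · have hsum : ∑ j with j < l.castLE hin, lamval y k j * Lval y j p.1 =
        -∑ j : Fin i, lamval y k (j.castLE hin) * p.2 j := by
      rw [← Finset.sum_neg_distrib, ← Finset.sum_filter_of_ne (p := (· < l))]
      · refine (Finset.sum_bij (fun j _ => Fin.castLE hin j) ?_ ?_ ?_ ?_).symm
        · intro j hj
          simpa using hj
        · intro a _ b _ h
          simpa using h
        · intro b hb
          have hb' : (b : ℕ) < l := by simpa [Fin.lt_def] using hb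
          exact ⟨⟨b, hb'.trans l.2⟩, Finset.mem_filter.mpr ⟨Finset.mem_univ _, hb'⟩, rfl⟩
        · intro j _
          rw [hz]
          ring
      · intro j _ hj
        have : j ≠ l := by
          rintro rfl
          simp [hpl] at hj
        omega
    have hqk := hq k p.1 hx
    have hfk := hf k
    rw [ratval] at hfk
    rw [hsum]
    field_simp at hfk
    linear_combination hfk

/-- Let `f = (f_1, …, f_n)` be a system of `n` algebraic (rational, with
nonvanishing denominators) functions on a connected `n`-dimensional algebraic
manifold `X` embedded in `ℂ^A`, and for `i = 1, …, n` let `E_i(f)` be the embedded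
system in the variables `(x, z_1, …, z_i)`.  Then there is a nonempty Zariski open
set `U` of parameter values in `ℂ^{n×(A+1)} × ℂ^{n×n}` such that for each
`i = 1, …, n`, the solutions of `E_i(x, z_1, …, z_i) = 0` with `(z_1, …, z_i) ≠ 0`
coincide with the solutions of `E_i(x, z_1, …, z_i) = 0` with `z_i ≠ 0`. -/
theorem embedding_nonzero_slack_iff_last_nonzero (A n : ℕ) (hn : 0 < n) (hnA : n ≤ A)
    (X : Set (Fin A → ℂ)) (hX : IsAffineAlgebraicManifold A n X)
    (fp fq : Fin n → MvPolynomial (Fin A) ℂ)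
    (hq : ∀ k, ∀ x ∈ X, MvPolynomial.eval x (fq k) ≠ 0) :
    ∃ U : Set (EmbParam A n → ℂ), IsZariskiOpen U ∧ U.Nonempty ∧
      ∀ y ∈ U, ∀ (i : ℕ) (hi1 : 1 ≤ i) (hin : i ≤ n),
        {p ∈ ESol X fp fq i hin y | p.2 ≠ 0} =
        {p ∈ ESol X fp fq i hin y | p.2 ⟨i - 1, by omega⟩ ≠ 0} := by
  choose! g hg0 hg using fun (a : Fin n × Fin n) (ha : a.2 < a.1) =>
    exists_vanishing_degenerateParams hnA hX hq ha
  let P : MvPolynomial (EmbParam A n) ℂ := ∏ a with a.2 < a.1, g a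
  have hP : P ≠ 0 := Finset.prod_ne_zero_iff.mpr fun a ha => hg0 a (Finset.mem_filter.mp ha).2
  refine ⟨{y | MvPolynomial.eval y P ≠ 0}, ⟨{P}, ?_⟩, ?_, ?_⟩
  · ext y
    simp [zlocus]
  · by_contra hempty
    refine hP (MvPolynomial.funext fun y => ?_)
    by_contra hy
    exact hempty ⟨y, by simpa using hy⟩
  · intro y hy i hi1 hin
    ext p
    refine and_congr_right fun hp => ⟨fun hz hlast => hy ?_, fun hlast hz => hlast (by simp [hz])⟩
    obtain ⟨j₀, hj₀⟩ := Function.ne_iff.mp hz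
    obtain ⟨hlt, hmem⟩ := mem_degenerateParams_of_last_eq_zero hq hin hp
      (l := ⟨i - 1, by omega⟩) (by simp; omega) hlast hj₀
    have hlt' : j₀.castLE hin < Fin.castLE hin ⟨i - 1, by omega⟩ := hlt
    rw [map_prod]
    exact Finset.prod_eq_zero
      (Finset.mem_filter.mpr ⟨Finset.mem_univ (Fin.castLE hin ⟨i - 1, by omega⟩, j₀.castLE hin),
        hlt'⟩) (hg (_, _) hlt' y hmem)
end
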